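/- Consider problem (P), let x̄ ∈ X be a solution of (P), and suppose the Slater condition holds. Suppose there exist m ∈ ℕ ∪ {0} and a solution λ = (λ_1, λ_2, …) ∈ ℓ^∞ with λ_k ≥ 0 of the dual (D_m) such that: (i) the functions f_0, λ_k f_k (k = 1, …, m) and λ_k f_k⁺ (k = m+1, m+2, …) are lower semicontinuous on a neighbourhood of x̄; (ii) the collection {f_0, λ_k f_k (k = 1, …, m), λ_k f_k⁺ (k = m+1, m+2, …)} is uniformly lower semicontinuous on a neighbourhood of x̄. Then λ_k f_k(x̄) = 0 for k = 1, …, m, and for every ε > 0 and M > m there exist n ∈ ℕ with n > M and points x_0, …, x_n ∈ B_ε(x̄) such that f_0(x_0) + ∑_{k=1}^m λ_k f_k(x_k) + ∑_{k=m+1}^n λ_k f_k⁺(x_k) ≤ f_0(x̄) and 0 ∈ ∂f_0(x_0) + ∑_{k=1}^m λ_k ∂f_k(x_k) + ∑_{k=m+1}^n λ_k ∂f_k⁺(x_k) + εB*, where for λ_k = 0 the terms λ_k ∂f_k(x_k) and λ_k ∂f_k⁺(x_k) are read as the normal cone N_{dom f_k}(x_k) := { x* ∈ X* : ⟨x*,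 x − x_k⟩ ≤ 0 for all x ∈ dom f_k }. -/

import Mathlib

open scoped BigOperators Pointwise

noncomputable section

/-- Convexity of an extended-real-valued function, via convexity of the epigraph. -/
def ConvexE {X : Type*} [AddCommGroup X] [Module ℝ X] (g : X → EReal) : Prop :=
  Convex ℝ {p : X × ℝ | g p.1 ≤ (p.2 : EReal)}

/-- A proper extended-real-valued function: never −∞ and not identically +∞. -/
def ProperE {X : Type*} (g : X → EReal) : Prop := (∀ x, g x ≠ ⊥) ∧ ∃ x, g x ≠ ⊤

/-- Scalar multiplication of an extended real by a real number, with the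
convention 0 · (+∞) = +∞. -/
def smulE (c : ℝ) (a : EReal) : EReal := if a = ⊤ then ⊤ else (c : EReal) * a

-- In the data `f : ℕ → X → EReal`, `f 0` is the objective and `f k` (k ≥ 1)
-- are the constraint functions of problem (P): minimize f 0 x subject to f k x ≤ 0 (k ≥ 1).

/-- The limit function f_∞ := limsup_{k→∞} f_k. -/
def fLim {X : Type*} (f : ℕ → X → EReal) (x : X) : EReal :=
  Filter.limsup (fun k => f k x) Filter.atTop

/-- The Lagrangian L(x, λ, λ_∞) = f_0(x) + ∑̄_{k∈ℕ} λ_k f_k(x) + λ_∞ f_∞(x)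
of the dual problem (D), where ∑̄ is the upper limit of partial sums. -/
def lagD {X : Type*} (f : ℕ → X → EReal) (lam : ℕ → ℝ) (lamInf : ℝ) (x : X) : EReal :=
  f 0 x + Filter.limsup (fun n => ∑ k ∈ Finset.Icc 1 n, smulE (lam k) (f k x)) Filter.atTop
    + smulE lamInf (fLim f x)

/-- The Lagrangian L_m(x, λ) = f_0(x) + ∑_{k=1}^m λ_k f_k(x) + ∑̄_{k>m} λ_k f_k⁺(x)
of the dual problem (D_m). -/
def lagDm {X : Type*} (f : ℕ → X → EReal) (m : ℕ) (lam : ℕ → ℝ) (x : X) : EReal :=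
  f 0 x + ∑ k ∈ Finset.Icc 1 m, smulE (lam k) (f k x)
    + Filter.limsup (fun n => ∑ k ∈ Finset.Icc (m + 1) n, smulE (lam k) (max (f k x) 0))
        Filter.atTop

/-- Membership in ℓ¹ with nonnegative entries. -/
def memL1 (lam : ℕ → ℝ) : Prop := Summable lam ∧ ∀ k, 0 ≤ lam k

/-- Membership in ℓ^∞ with nonnegative entries. -/
def memLinfty (lam : ℕ → ℝ) : Prop := (∃ M : ℝ, ∀ k, |lam k| ≤ M) ∧ ∀ k, 0 ≤ lam k

/-- The optimal value v(P) of problem (P). -/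
def vP {X : Type*} (f : ℕ → X → EReal) : EReal :=
  ⨅ (x : X) (_ : ∀ k, 1 ≤ k → f k x ≤ 0), f 0 x

/-- The optimal value v(P_ε) of the perturbed problem (P_ε). -/
def vPeps {X : Type*} (f : ℕ → X → EReal) (ε : ℝ) : EReal :=
  ⨅ (x : X) (_ : ∀ k, 1 ≤ k → f k x ≤ (ε : EReal)), f 0 x

/-- The optimal value v(D) of the dual problem (D). -/
def vD {X : Type*} (f : ℕ → X → EReal) : EReal :=
  ⨆ (lam : ℕ → ℝ) (lamInf : ℝ) (_ : memL1 lam ∧ 0 ≤ lamInf), ⨅ x : X, lagD f lam lamInf x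

/-- The optimal value v(D_m) of the dual problem (D_m). -/
def vDm {X : Type*} (f : ℕ → X → EReal) (m : ℕ) : EReal :=
  ⨆ (lam : ℕ → ℝ) (_ : memLinfty lam), ⨅ x : X, lagDm f m lam x

/-- The Slater condition for problem (P). -/
def SlaterE {X : Type*} (f : ℕ → X → EReal) : Prop :=
  ∃ x : X, f 0 x ≠ ⊤ ∧ (⨆ (k : ℕ) (_ : 1 ≤ k), f k x) < 0

/-- Feasibility of x for (P) together with nonemptiness data C ≠ ∅. -/
def feasE {X : Type*} (f : ℕ → X → EReal) (x : X) : Prop := ∀ k, 1 ≤ k → f k x ≤ 0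

/-- The infinite (upper) sum of a family of extended-real-valued functions. -/
def upperSum {X : Type*} {T : Type*} (f : T → X → EReal) (x : X) : EReal :=
  ⨅ S₀ : Finset T, ⨆ S : Finset T, ⨆ _ : S₀ ⊆ S, ∑ t ∈ S, f t x

/-- The uniform infimum Λ_U of a family of functions on a set U. -/
def unifInf {X : Type*} [NormedAddCommGroup X] {T : Type*}
    (f : T → X → EReal) (U : Set X) : EReal :=
  ⨆ S₀ : Finset T, ⨅ S : Finset T, ⨅ _ : S₀ ⊆ S,
    ⨆ (δ : ℝ) (_ : 0 < δ),
      ⨅ (x : T → X) (_ : (∀ t ∈ S, x t ∈ U) ∧ ∀ s ∈ S, ∀ t ∈ S, dist (x s) (x t) ≤ δ),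
        ∑ t ∈ S, f t (x t)

/-- The convex (Fenchel) subdifferential of an extended-real-valued function. -/
def subdiffE {X : Type*} [NormedAddCommGroup X] [NormedSpace ℝ X]
    (g : X → EReal) (x₀ : X) : Set (X →L[ℝ] ℝ) :=
  {p | ∀ x, g x₀ + (p (x - x₀) : EReal) ≤ g x}

/-- The normal cone to the domain of `g` at `x₀`. -/
def normalConeE {X : Type*} [NormedAddCommGroup X] [NormedSpace ℝ X]
    (g : X → EReal) (x₀ : X) : Set (X →L[ℝ] ℝ) :=
  {p | ∀ x, g x ≠ ⊤ → p (x - x₀) ≤ 0}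

/-- The collection {f_0, λ_k f_k (k = 1, …, m), λ_k f_k⁺ (k = m+1, …)} indexed by ℕ. -/
def collDm {X : Type*} (f : ℕ → X → EReal) (m : ℕ) (lam : ℕ → ℝ) : ℕ → X → EReal :=
  fun k x => if k = 0 then f 0 x
    else if k ≤ m then smulE (lam k) (f k x) else smulE (lam k) (max (f k x) 0)

theorem ekeland_real {Y : Type*} [MetricSpace Y] [CompleteSpace Y] {g : Y → ℝ}
    (hg : LowerSemicontinuous g) {b : ℝ} (hb : ∀ y, b ≤ g y) {η : ℝ} (hη : 0 < η) (x₀ : Y) :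
    ∃ x, g x + η * dist x x₀ ≤ g x₀ ∧ ∀ y, g x ≤ g y + η * dist x y := by
  have step : ∀ (k : ℕ) (x : Y), ∃ x', g x' + η * dist x' x ≤ g x ∧
      ∀ y, g y + η * dist y x ≤ g x → g x' ≤ g y + (1 / 2 : ℝ) ^ k := by
    intro k x
    set A : Set ℝ := g '' {y | g y + η * dist y x ≤ g x}
    have hA : A.Nonempty := ⟨g x, x, by simp, rfl⟩
    have hAb : BddBelow A := ⟨b, by rintro _ ⟨y, -, rfl⟩; exact hb y⟩
    obtain ⟨_, ⟨x', hx', rfl⟩, hlt⟩ :=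
      exists_lt_of_csInf_lt hA (show sInf A < sInf A + (1 / 2 : ℝ) ^ k by simp)
    exact ⟨x', hx', fun y hy => by linarith [csInf_le hAb ⟨y, hy, rfl⟩]⟩
  choose s hs₁ hs₂ using step
  let u : ℕ → Y := fun k => Nat.rec x₀ (fun k x => s k x) k
  have hu : ∀ k, u (k + 1) = s k (u k) := fun k => rfl
  have hu₁ : ∀ k, g (u (k + 1)) + η * dist (u (k + 1)) (u k) ≤ g (u k) := fun k => by
    rw [hu]; exact hs₁ _ _
  have trans : ∀ {x y z}, g x + η * dist x y ≤ g y → g y + η * dist y z ≤ g z →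
      g x + η * dist x z ≤ g z := fun {x y z} h₁ h₂ => by
    nlinarith [dist_triangle x y z]
  have hmono : ∀ k j, g (u (k + j)) + η * dist (u (k + j)) (u k) ≤ g (u k) := by
    intro k j
    induction j with
    | zero => simp
    | succ j ih => exact trans (hu₁ (k + j)) ih
  have hsum : Summable fun k => dist (u k) (u (k + 1)) := by
    refine summable_of_sum_range_le (c := (g x₀ - b) / η) (fun _ => dist_nonneg) fun n => ?_
    rw [le_div_iff₀ hη]
    have : (∑ i ∈ Finset.range n, dist (u i) (u (i + 1))) * η ≤ g (u 0) - g (u n) := by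
      induction n with
      | zero => simp
      | succ n ih =>
        rw [Finset.sum_range_succ, add_mul]
        have := hu₁ n
        rw [dist_comm] at this
        linarith
    exact this.trans (sub_le_sub_left (hb _) _)
  obtain ⟨x, hx⟩ := cauchySeq_tendsto_of_complete (cauchySeq_of_summable_dist hsum)
  have hlim : ∀ k, g x + η * dist x (u k) ≤ g (u k) := by
    intro k
    have hl : LowerSemicontinuous fun z => g z + η * dist z (u k) :=
      hg.add (by fun_prop : Continuous fun z => η * dist z (u k)).lowerSemicontinuous
    refine (hl.isClosed_preimage (g (u k))).mem_of_tendsto hx ?_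
    filter_upwards [Filter.eventually_ge_atTop k] with j hj
    obtain ⟨i, rfl⟩ := Nat.exists_eq_add_of_le hj
    exact hmono k i
  refine ⟨x, hlim 0, fun y => ?_⟩
  by_contra! hy
  have hy' : g y + η * dist y x ≤ g x := by rw [dist_comm]; exact hy.le
  have hle : ∀ k : ℕ, g x - g y ≤ (1 / 2 : ℝ) ^ k := fun k => by
    have h₁ := hs₂ k (u k) y (trans hy' (hlim k))
    have h₂ := hlim (k + 1)
    rw [hu] at h₂
    have : 0 ≤ η * dist x (s k (u k)) := by positivity
    linarith
  have h0 := ge_of_tendsto' (tendsto_pow_atTop_nhds_zero_of_lt_one (by norm_num)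
    (by norm_num : (1 / 2 : ℝ) < 1)) hle
  have : 0 ≤ η * dist x y := by positivity
  linarith

theorem ekeland_ereal {Y : Type*} [MetricSpace Y] [CompleteSpace Y] {g : Y → EReal}
    (hg : LowerSemicontinuous g) {b : ℝ} (hb : ∀ y, (b : EReal) ≤ g y) {η : ℝ} (hη : 0 < η)
    {x₀ : Y} {v : ℝ} (hv : g x₀ = v) :
    ∃ x, ∃ w : ℝ, g x = w ∧ w + η * dist x x₀ ≤ v ∧
      ∀ y, ∀ r : ℝ, g y ≤ r → w ≤ r + η * dist x y := by
  let T : Set Y := g ⁻¹' Set.Iic (v : EReal)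
  have hT : IsClosed T := hg.isClosed_preimage _
  have : CompleteSpace T := hT.completeSpace_coe
  have hfin : ∀ y : T, ((g y).toReal : EReal) = g y := fun y =>
    EReal.coe_toReal (ne_top_of_le_ne_top (EReal.coe_ne_top v) y.2)
      (ne_bot_of_le_ne_bot (EReal.coe_ne_bot b) (hb y))
  have hlsc : LowerSemicontinuous fun y : T => (g y).toReal := by
    intro y c hc
    have h : (c : EReal) < g y := by rw [← hfin y]; exact_mod_cast hc
    filter_upwards [(hg.comp continuous_subtype_val) y c h] with z hz
    rw [Function.comp_apply, ← hfin z] at hz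
    exact_mod_cast hz
  obtain ⟨x, hx₁, hx₂⟩ := ekeland_real hlsc (b := b)
    (fun y => by have := hb y; rw [← hfin y] at this; exact_mod_cast this) hη ⟨x₀, hv.le⟩
  refine ⟨x, (g x).toReal, (hfin x).symm, by simpa [hv, Subtype.dist_eq] using hx₁, fun y r hr => ?_⟩
  by_cases hy : g y ≤ v
  · have h := hx₂ ⟨y, hy⟩
    have h' : (g y).toReal ≤ r := by
      have := hfin ⟨y, hy⟩
      rw [← this] at hr
      exact_mod_cast hr
    simp only [Subtype.dist_eq] at h
    linarith
  · have h1 : (v : EReal) < r := (not_le.1 hy).trans_le hr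
    have h2 : v < r := by exact_mod_cast h1
    have h3 : (g x).toReal ≤ v := by
      have h := x.2
      have h' : g x ≤ v := h
      rw [← hfin x] at h'
      exact_mod_cast h'
    have : 0 ≤ η * dist (x : Y) y := by positivity
    linarith

theorem lowerSemicontinuous_sum_ereal {Y ι : Type*} [TopologicalSpace Y] (s : Finset ι)
    {F : ι → Y → EReal} (hne : ∀ i y, F i y ≠ ⊥) (hF : ∀ i, LowerSemicontinuous (F i)) :
    (∀ y, ∑ i ∈ s, F i y ≠ ⊥) ∧ LowerSemicontinuous fun y => ∑ i ∈ s, F i y := by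
  classical
  induction s using Finset.induction_on with
  | empty => simpa using lowerSemicontinuous_const
  | insert a s ha ih =>
    simp only [Finset.sum_insert ha]
    refine ⟨fun y => by simp [EReal.add_eq_bot_iff, hne, ih.1 y], ?_⟩
    exact (hF a).add' ih.2 fun y => EReal.continuousAt_add (Or.inr (ih.1 y)) (Or.inl (hne a y))

theorem exists_clm_le_of_convex {E : Type*} [NormedAddCommGroup E] [NormedSpace ℝ E]
    {N : Seminorm ℝ E} (hN : Continuous N) {K : Set (E × ℝ)} (hK : Convex ℝ K) (h0 : 0 ∈ K)
    (hle : ∀ z ∈ K, -N z.1 ≤ z.2) :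
    ∃ p : E →L[ℝ] ℝ, (∀ h, p h ≤ N h) ∧ ∀ z ∈ K, p z.1 ≤ z.2 := by
  let A : Set (E × ℝ) := {z | z.2 < -N z.1}
  have hAo : IsOpen A := isOpen_lt continuous_snd (hN.comp continuous_fst).neg
  have hAc : Convex ℝ A := by
    intro x hx y hy a b ha hb hab
    simp only [A, Set.mem_ofPred_eq, Prod.snd_add, Prod.fst_add, Prod.smul_fst, Prod.smul_snd,
      smul_eq_mul] at *
    have h1 := map_add_le_add N (a • x.1) (b • y.1)
    rw [map_smul_eq_mul, map_smul_eq_mul, Real.norm_of_nonneg ha, Real.norm_of_nonneg hb] at h1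
    rcases ha.eq_or_lt with rfl | ha
    · have : b = 1 := by linarith
      subst this
      simp at h1 ⊢
      linarith
    · nlinarith
  have hdisj : Disjoint A K := Set.disjoint_left.2 fun z hz hzK => (hle z hzK).not_gt hz
  obtain ⟨f, u, hfA, hfK⟩ := geometric_hahn_banach_open hAc hAo hK hdisj
  set f₁ : E →L[ℝ] ℝ := f.comp (ContinuousLinearMap.inl ℝ E ℝ)
  set c : ℝ := f (0, 1)
  have hf : ∀ z : E × ℝ, f z = f₁ z.1 + c * z.2 := by
    intro z
    have : z = (z.1, 0) + z.2 • ((0 : E), (1 : ℝ)) := by ext <;> simp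
    conv_lhs => rw [this]
    rw [map_add, map_smul]
    simp [f₁, c, mul_comm]
  have hu : u ≤ 0 := by simpa using hfK 0 h0
  have hA : ∀ (h : E) (t : ℝ), 0 < t → f₁ h + c * (-N h - t) < u := fun h t ht => by
    have := hfA (h, -N h - t) (by simp [A, ht])
    rwa [hf] at this
  have hc : 0 < c := by
    have := hA 0 1 one_pos
    simp at this
    linarith
  have hfN : ∀ h, f₁ h - c * N h ≤ u := fun h => by
    refine le_of_forall_pos_le_add fun e he => ?_
    have := hA h (e / c) (by positivity)
    have h2 : c * (-N h - e / c) = -(c * N h) - e := by field_simp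
    rw [h2] at this
    linarith
  have hu0 : u = 0 := le_antisymm hu (by simpa using hfN 0)
  subst hu0
  refine ⟨-(c⁻¹ • f₁), fun h => ?_, fun z hz => ?_⟩
  · have := hfN (-h)
    simp only [map_neg, map_neg_eq_map] at this
    simp only [neg_apply, smul_apply, smul_eq_mul]
    rw [← mul_neg, inv_mul_le_iff₀ hc]
    linarith
  · have := hfK z hz
    rw [hf] at this
    simp only [neg_apply, smul_apply, smul_eq_mul]
    rw [← mul_neg, inv_mul_le_iff₀ hc]
    linarith

theorem EReal.coe_finsetSum {ι : Type*} (s : Finset ι) (r : ι → ℝ) :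
    ((∑ i ∈ s, r i : ℝ) : EReal) = ∑ i ∈ s, (r i : EReal) := by
  classical
  induction s using Finset.induction_on with
  | empty => simp
  | insert a s ha ih => rw [Finset.sum_insert ha, Finset.sum_insert ha, EReal.coe_add, ih]

theorem EReal.sum_ne_bot {ι : Type*} {s : Finset ι} {a : ι → EReal} (ha : ∀ i ∈ s, a i ≠ ⊥) :
    ∑ i ∈ s, a i ≠ ⊥ := by
  classical
  induction s using Finset.induction_on with
  | empty => simp
  | insert j s hj ih =>
    rw [Finset.sum_insert hj, EReal.add_ne_bot_iff]
    exact ⟨ha j (by simp), ih fun i hi => ha i (by simp [hi])⟩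

/-- A finite sum of extended reals different from `⊥` that is not `⊤` has real terms. -/
theorem EReal.exists_coe_of_sum_ne_top {ι : Type*} {s : Finset ι} {a : ι → EReal}
    (ha : ∀ i ∈ s, a i ≠ ⊥) (h : ∑ i ∈ s, a i ≠ ⊤) : ∃ r : ι → ℝ, ∀ i ∈ s, a i = r i := by
  classical
  refine ⟨fun i => (a i).toReal, fun i hi => (EReal.coe_toReal ?_ (ha i hi)).symm⟩
  intro htop
  apply h
  rw [← Finset.add_sum_erase s a hi, htop]
  exact EReal.top_add_of_ne_bot (EReal.sum_ne_bot fun j hj => ha j (Finset.mem_of_mem_erase hj))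

theorem ConvexE.le {X : Type*} [AddCommGroup X] [Module ℝ X] {g : X → EReal} (hg : ConvexE g)
    {x y : X} {r s a b : ℝ} (hx : g x ≤ r) (hy : g y ≤ s) (ha : 0 ≤ a) (hb : 0 ≤ b)
    (hab : a + b = 1) : g (a • x + b • y) ≤ ((a * r + b * s : ℝ) : EReal) :=
  hg (x := (x, r)) hx (y := (y, s)) hy ha hb hab

theorem ConvexE.bddBelow_on_closedBall {X : Type*} [NormedAddCommGroup X] [NormedSpace ℝ X]
    {g : X → EReal} (hg : ConvexE g) (hne : ∀ x, g x ≠ ⊥) {x₀ : X} {a R : ℝ} (hR : 0 < R)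
    (ha : g x₀ = a) (hlsc : LowerSemicontinuousOn g (Metric.ball x₀ R)) (ρ : ℝ) (hρ : 0 < ρ) :
    ∃ B : ℝ, ∀ x ∈ Metric.closedBall x₀ ρ, (B : EReal) ≤ g x := by
  have h := hlsc x₀ (Metric.mem_ball_self hR) ((a - 1 : ℝ) : EReal)
    (show ((a - 1 : ℝ) : EReal) < g x₀ by rw [ha]; exact_mod_cast sub_one_lt a)
  rw [Metric.isOpen_ball.nhdsWithin_eq (Metric.mem_ball_self hR)] at h
  obtain ⟨r, hr, hball⟩ := Metric.eventually_nhds_iff_ball.1 h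
  set θ : ℝ := min (r / (2 * ρ)) 1
  have hθ : 0 < θ := by positivity
  have hθ1 : θ ≤ 1 := min_le_right _ _
  refine ⟨a - 1 / θ, fun x hx => ?_⟩
  rcases eq_or_ne (g x) ⊤ with htop | htop
  · rw [htop]; exact le_top
  obtain ⟨s, hs⟩ : ∃ s : ℝ, g x = s := ⟨_, (EReal.coe_toReal htop (hne x)).symm⟩
  have h1 := hg.le ha.le hs.le (a := 1 - θ) (b := θ) (by linarith) hθ.le (by ring)
  have h2 : ((a - 1 : ℝ) : EReal) < g ((1 - θ) • x₀ + θ • x) := by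
    apply hball
    have : (1 - θ) • x₀ + θ • x - x₀ = θ • (x - x₀) := by module
    rw [mem_ball_iff_norm, this, norm_smul, Real.norm_of_nonneg hθ.le]
    rw [mem_closedBall_iff_norm] at hx
    calc θ * ‖x - x₀‖ ≤ r / (2 * ρ) * ρ := by gcongr; exact min_le_left _ _
      _ = r / 2 := by field_simp
      _ < r := by linarith
  have h3 : a - 1 < (1 - θ) * a + θ * s := by exact_mod_cast h2.trans_le h1
  rw [hs]
  norm_cast
  rw [sub_le_iff_le_add, ← sub_le_iff_le_add', le_div_iff₀ hθ]
  nlinarith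

/-- Approximate decoupled minimization: an Ekeland point for the sum of convex functions with
decoupled variables, the coupling being penalized. -/
theorem exists_decoupled_approx_min {X ι : Type*} [NormedAddCommGroup X] [NormedSpace ℝ X]
    [CompleteSpace X] [Fintype ι] (i₀ : ι) {F : ι → X → EReal} (hne : ∀ i x, F i x ≠ ⊥)
    (hconv : ∀ i, ConvexE (F i)) {xb : X} {R : ℝ} (hR : 0 < R)
    (hlsc : ∀ i, LowerSemicontinuousOn (F i) (Metric.ball xb R)) {v : ℝ}
    (hv : ∑ i, F i xb = v) {e δ : ℝ} (he : 0 < e) (hδ : 0 < δ)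
    (hlow : ∀ y : ι → X, (∀ i, y i ∈ Metric.ball xb R) → (∀ i j, dist (y i) (y j) ≤ δ) →
      ((v - e : ℝ) : EReal) ≤ ∑ i, F i (y i)) :
    ∃ (y : ι → X) (a : ι → ℝ) (γ : ℝ), 0 ≤ γ ∧ dist y (fun _ => xb) ≤ R / 4 ∧
      (∀ i, F i (y i) = a i) ∧ ∑ i, a i ≤ v ∧
      ∀ (z : ι → X) (r : ι → ℝ), dist z (fun _ => xb) ≤ R / 2 → (∀ i, F i (z i) ≤ r i) →
        ∑ i, a i ≤ ∑ i, r i + (γ * ∑ i, ‖(z i - y i) - (z i₀ - y i₀)‖ + 4 * e / R * ‖z - y‖) := by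
  classical
  obtain ⟨ab, hab⟩ := EReal.exists_coe_of_sum_ne_top (fun i _ => hne i xb)
    (by rw [hv]; exact EReal.coe_ne_top v)
  choose B hB using fun i => (hconv i).bddBelow_on_closedBall (hne i) hR (hab i (by simp)) (hlsc i)
    (R / 2) (by positivity)
  set γ : ℝ := |v - ∑ i, B i| * (2 / δ)
  have hγ : 0 ≤ γ := by positivity
  set c : ι → X := fun _ => xb
  let Y : Set (ι → X) := Metric.closedBall c (R / 2)
  have : CompleteSpace Y := Metric.isClosed_closedBall.completeSpace_coe
  have hYi : ∀ (y : Y) i, (y : ι → X) i ∈ Metric.closedBall xb (R / 2) := fun y i =>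
    (dist_pi_le_iff (by positivity)).1 (Metric.mem_closedBall.1 y.2) i
  have hYb : ∀ (y : Y) i, (y : ι → X) i ∈ Metric.ball xb R := fun y i =>
    Metric.closedBall_subset_ball (by linarith) (hYi y i)
  let ψ : (ι → X) → ℝ := fun y => γ * ∑ i, ‖y i - y i₀‖
  have hψ0 : ∀ y, 0 ≤ ψ y := fun y => by positivity
  have hψ : Continuous ψ := by fun_prop
  let φ : Y → EReal := fun y => ∑ i, F i ((y : ι → X) i) + (ψ y : EReal)
  have hφ : LowerSemicontinuous φ := by
    have h := lowerSemicontinuous_sum_ereal (Y := Y) Finset.univ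
      (F := fun i y => F i ((y : ι → X) i)) (fun i y => hne i _) fun i y q hq => by
        have h1 := hlsc i _ (hYb y i) q hq
        rw [Metric.isOpen_ball.nhdsWithin_eq (hYb y i)] at h1
        exact ((continuous_apply i).comp continuous_subtype_val).continuousAt.eventually h1
    refine h.2.add' (continuous_coe_real_ereal.comp
      (hψ.comp continuous_subtype_val)).lowerSemicontinuous fun y => ?_
    exact EReal.continuousAt_add (Or.inr (EReal.coe_ne_bot _)) (Or.inl (h.1 y))
  have hbd : ∀ y, ((v - e : ℝ) : EReal) ≤ φ y := by
    intro y
    by_cases hy : ∀ i, ‖(y : ι → X) i - (y : ι → X) i₀‖ ≤ δ / 2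
    · have h1 := hlow y (hYb y) fun i j => by
        rw [dist_eq_norm]
        calc ‖(y : ι → X) i - (y : ι → X) j‖
            = ‖((y : ι → X) i - (y : ι → X) i₀) - ((y : ι → X) j - (y : ι → X) i₀)‖ := by
              congr 1; abel
          _ ≤ δ / 2 + δ / 2 := (norm_sub_le _ _).trans (add_le_add (hy i) (hy j))
          _ = δ := by ring
      calc _ ≤ _ := h1
        _ = ∑ i, F i ((y : ι → X) i) + 0 := by rw [add_zero]
        _ ≤ _ := by
          refine add_le_add le_rfl ?_
          exact_mod_cast hψ0 y
    · push Not at hy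
      obtain ⟨j, hj⟩ := hy
      have h1 : |v - ∑ i, B i| ≤ ψ y := by
        have h2 : δ / 2 ≤ ∑ i, ‖(y : ι → X) i - (y : ι → X) i₀‖ := hj.le.trans
          (Finset.single_le_sum (f := fun i => ‖(y : ι → X) i - (y : ι → X) i₀‖)
            (fun _ _ => norm_nonneg _) (Finset.mem_univ j))
        calc |v - ∑ i, B i| = γ * (δ / 2) := by simp only [γ]; field_simp
          _ ≤ _ := by simp only [ψ]; gcongr
      calc ((v - e : ℝ) : EReal) ≤ ((∑ i, B i + ψ y : ℝ) : EReal) := by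
            norm_cast
            linarith [le_abs_self (v - ∑ i, B i)]
        _ ≤ _ := by
          rw [EReal.coe_add, EReal.coe_finsetSum]
          exact add_le_add (Finset.sum_le_sum fun i _ => hB i _ (hYi y i)) le_rfl
  obtain ⟨y, w, hw, hwv, hmin⟩ := ekeland_ereal hφ hbd (η := 4 * e / R) (by positivity)
    (x₀ := ⟨c, by simp [Y]; positivity⟩) (v := v) (by simp [φ, ψ, c, hv])
  have hwe : v - e ≤ w := by
    have h := hbd y
    rw [hw] at h
    exact_mod_cast h
  have hsum : ∑ i, F i ((y : ι → X) i) ≠ ⊤ := by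
    intro h
    simp [φ, h] at hw
  obtain ⟨a, ha⟩ := EReal.exists_coe_of_sum_ne_top (fun i _ => hne i _) hsum
  have hwa : ∑ i, a i + ψ y = w := by
    simp only [φ] at hw
    rw [Finset.sum_congr rfl ha, ← EReal.coe_finsetSum] at hw
    exact_mod_cast hw
  have hdist : dist (y : ι → X) c ≤ R / 4 := by
    have h1 : 4 * e / R * dist (y : ι → X) c ≤ e := by
      have h2 : w + 4 * e / R * dist (y : ι → X) c ≤ v := hwv
      linarith
    rw [div_mul_eq_mul_div, div_le_iff₀ hR] at h1
    nlinarith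
  refine ⟨y, a, γ, hγ, hdist, fun i => ha i (by simp), ?_, fun z r hz hr => ?_⟩
  · have h2 : w + 4 * e / R * dist (y : ι → X) c ≤ v := hwv
    have : 0 ≤ 4 * e / R * dist (y : ι → X) c := by positivity
    linarith [hψ0 y]
  · have h := hmin ⟨z, hz⟩ (∑ i, r i + ψ z) (by
      simp only [φ]
      rw [EReal.coe_add, EReal.coe_finsetSum]
      exact add_le_add (Finset.sum_le_sum fun i _ => hr i) le_rfl)
    have h3 : w ≤ ∑ i, r i + ψ z + 4 * e / R * ‖z - (y : ι → X)‖ := by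
      rw [← dist_eq_norm, dist_comm]; exact h
    have h4 : ψ z ≤ γ * ∑ i, ‖(z i - (y : ι → X) i) - (z i₀ - (y : ι → X) i₀)‖ + ψ y := by
      simp only [ψ]
      rw [← mul_add, ← Finset.sum_add_distrib]
      gcongr with i
      calc ‖z i - z i₀‖ = ‖((z i - (y : ι → X) i) - (z i₀ - (y : ι → X) i₀)) +
            ((y : ι → X) i - (y : ι → X) i₀)‖ := by congr 1; abel
        _ ≤ _ := norm_add_le _ _
    linarith

/-- Fuzzy sum rule: if the decoupled sum of convex functions is almost bounded below by its value
at `xb`, there are subgradients at nearby points with small sum. -/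
theorem exists_subdiffE_norm_sum_le {X ι : Type*} [NormedAddCommGroup X] [NormedSpace ℝ X]
    [CompleteSpace X] [Fintype ι] (i₀ : ι) {F : ι → X → EReal} (hne : ∀ i x, F i x ≠ ⊥)
    (hconv : ∀ i, ConvexE (F i)) {xb : X} {R : ℝ} (hR : 0 < R)
    (hlsc : ∀ i, LowerSemicontinuousOn (F i) (Metric.ball xb R)) {v : ℝ}
    (hv : ∑ i, F i xb = v) {e δ : ℝ} (he : 0 < e) (hδ : 0 < δ)
    (hlow : ∀ y : ι → X, (∀ i, y i ∈ Metric.ball xb R) → (∀ i j, dist (y i) (y j) ≤ δ) →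
      ((v - e : ℝ) : EReal) ≤ ∑ i, F i (y i)) :
    ∃ (y : ι → X) (p : ι → X →L[ℝ] ℝ), (∀ i, y i ∈ Metric.ball xb R) ∧
      ∑ i, F i (y i) ≤ v ∧ (∀ i, p i ∈ subdiffE (F i) (y i)) ∧ ‖∑ i, p i‖ ≤ 4 * e / R := by
  classical
  obtain ⟨y, a, γ, hγ, hy, hFa, hav, hmin⟩ :=
    exists_decoupled_approx_min i₀ hne hconv hR hlsc hv he hδ hlow
  set η : ℝ := 4 * e / R
  have hη : 0 ≤ η := by positivity
  let N : Seminorm ℝ (ι → X) := Seminorm.of (fun h => γ * ∑ i, ‖h i - h i₀‖ + η * ‖h‖)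
    (fun h k => by
      have h1 : ∑ i, ‖(h + k) i - (h + k) i₀‖ ≤ ∑ i, ‖h i - h i₀‖ + ∑ i, ‖k i - k i₀‖ := by
        rw [← Finset.sum_add_distrib]
        gcongr with i
        calc ‖(h + k) i - (h + k) i₀‖ = ‖(h i - h i₀) + (k i - k i₀)‖ := by
              congr 1; simp only [Pi.add_apply]; abel
          _ ≤ _ := norm_add_le _ _
      have h2 := norm_add_le h k
      nlinarith)
    (fun t h => by
      simp only [Pi.smul_apply, ← smul_sub, norm_smul, ← Finset.mul_sum]
      ring)
  have hNdef : ∀ h, N h = γ * ∑ i, ‖h i - h i₀‖ + η * ‖h‖ := fun h => rfl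
  have hN : Continuous N := by
    have : (N : (ι → X) → ℝ) = fun h => γ * ∑ i, ‖h i - h i₀‖ + η * ‖h‖ := rfl
    rw [this]
    fun_prop
  let K : Set ((ι → X) × ℝ) := {z | ∃ r : ι → ℝ, (∀ i, F i (y i + z.1 i) ≤ r i) ∧
    ∑ i, r i - ∑ i, a i = z.2}
  have hK : Convex ℝ K := by
    rintro x ⟨r, hr, hrx⟩ x' ⟨s, hs, hsx⟩ t u ht hu htu
    refine ⟨fun i => t * r i + u * s i, fun i => ?_, ?_⟩
    · have h := (hconv i).le (hr i) (hs i) ht hu htu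
      convert h using 2
      simp only [Prod.fst_add, Prod.smul_fst, Pi.add_apply, Pi.smul_apply]
      have : y i = t • y i + u • y i := by rw [← add_smul, htu, one_smul]
      conv_lhs => rw [this]
      module
    · simp only [Prod.snd_add, Prod.smul_snd, smul_eq_mul, ← hrx, ← hsx]
      rw [Finset.sum_add_distrib, ← Finset.mul_sum, ← Finset.mul_sum]
      linear_combination (∑ i, a i) * htu
  have h0 : (0 : (ι → X) × ℝ) ∈ K := ⟨a, fun i => by simp [hFa], by simp⟩
  have hle : ∀ z ∈ K, -N z.1 ≤ z.2 := by
    rintro ⟨h, q⟩ ⟨r, hr, hrq⟩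
    simp only at hr hrq ⊢
    set θ : ℝ := min 1 (R / (4 * (‖h‖ + 1)))
    have hθ : 0 < θ := by positivity
    have hθ1 : θ ≤ 1 := min_le_left _ _
    have h1 := hmin (y + θ • h) (fun i => (1 - θ) * a i + θ * r i) (by
      calc dist (y + θ • h) (fun _ => xb) ≤ dist (y + θ • h) y + dist y (fun _ => xb) :=
            dist_triangle _ _ _
        _ ≤ R / 4 + R / 4 := by
          refine add_le_add ?_ hy
          rw [dist_eq_norm, add_sub_cancel_left, norm_smul, Real.norm_of_nonneg hθ.le]
          calc θ * ‖h‖ ≤ R / (4 * (‖h‖ + 1)) * (‖h‖ + 1) := by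
                gcongr
                · exact min_le_right _ _
                · linarith
            _ = R / 4 := by field_simp
        _ = R / 2 := by ring)
      (fun i => by
        have := (hconv i).le (hFa i).le (hr i) (a := 1 - θ) (b := θ) (by linarith) hθ.le (by ring)
        convert this using 2
        simp only [Pi.add_apply, Pi.smul_apply]
        module)
    have h2 : γ * ∑ i, ‖((y + θ • h) i - y i) - ((y + θ • h) i₀ - y i₀)‖ +
        η * ‖y + θ • h - y‖ = θ * N h := by
      have := map_smul_eq_mul N θ h
      rw [Real.norm_of_nonneg hθ.le] at this
      rw [← this, hNdef]
      simp
    rw [h2, Finset.sum_add_distrib, ← Finset.mul_sum, ← Finset.mul_sum] at h1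
    have h3 : 0 ≤ θ * (∑ i, r i - ∑ i, a i + N h) := by linarith
    have h4 := nonneg_of_mul_nonneg_right h3 hθ
    linarith
  obtain ⟨p, hpN, hpK⟩ := exists_clm_le_of_convex hN hK h0 hle
  refine ⟨y, fun i => p.comp (ContinuousLinearMap.single ℝ (fun _ => X) i), fun i => ?_, ?_,
    fun i x => ?_, ?_⟩
  · have := (dist_pi_le_iff (by positivity)).1 hy i
    exact Metric.mem_ball.2 (by linarith)
  · rw [Finset.sum_congr rfl fun i _ => hFa i, ← EReal.coe_finsetSum]
    exact_mod_cast hav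
  · rcases eq_or_ne (F i x) ⊤ with htop | htop
    · rw [htop]; exact le_top
    obtain ⟨s, hs⟩ : ∃ s : ℝ, F i x = s := ⟨_, (EReal.coe_toReal htop (hne i x)).symm⟩
    have h := hpK (Pi.single i (x - y i), s - a i) ⟨Function.update a i s, fun j => ?_, ?_⟩
    · rw [hFa, hs]
      simp only [ContinuousLinearMap.comp_apply, ContinuousLinearMap.single_apply]
      norm_cast
      simp only at h
      linarith
    · rcases eq_or_ne j i with rfl | hj
      · simp [hs]
      · simp [hj, hFa]
    · rw [Finset.sum_update_of_mem (Finset.mem_univ i),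
        ← Finset.add_sum_erase Finset.univ a (Finset.mem_univ i), Finset.sdiff_singleton_eq_erase]
      ring
  · refine ContinuousLinearMap.opNorm_le_bound _ hη fun h => ?_
    have hsum : (∑ i, p.comp (ContinuousLinearMap.single ℝ (fun _ => X) i)) h
        = p fun _ => h := by
      simp only [sum_apply, ContinuousLinearMap.comp_apply,
        ContinuousLinearMap.single_apply, ← map_sum]
      congr 1
      exact Finset.univ_sum_single fun _ => h
    have hNc : ∀ k : X, N (fun _ => k) ≤ η * ‖k‖ := fun k => by
      rw [hNdef]
      simp only [sub_self, norm_zero, Finset.sum_const_zero, mul_zero, zero_add]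
      gcongr
      exact pi_norm_const_le k
    rw [hsum, Real.norm_eq_abs, abs_le']
    refine ⟨(hpN _).trans (hNc h), ?_⟩
    rw [← map_neg]
    exact (hpN _).trans ((hNc (-h)).trans_eq (by rw [norm_neg]))

theorem smulE_coe (c r : ℝ) : smulE c (r : EReal) = ((c * r : ℝ) : EReal) := by
  simp [smulE]

theorem smulE_top (c : ℝ) : smulE c ⊤ = ⊤ := by
  simp [smulE]

theorem smulE_eq_top_iff {c : ℝ} {a : EReal} (ha : a ≠ ⊥) : smulE c a = ⊤ ↔ a = ⊤ := by
  induction a with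
  | bot => exact absurd rfl ha
  | coe r => simp [smulE_coe, -EReal.coe_mul]
  | top => simp [smulE_top]

theorem smulE_ne_bot {c : ℝ} {a : EReal} (ha : a ≠ ⊥) : smulE c a ≠ ⊥ := by
  induction a with
  | bot => exact absurd rfl ha
  | coe r => simp [smulE_coe, -EReal.coe_mul]
  | top => simp [smulE_top]

theorem smulE_nonneg {c : ℝ} (hc : 0 ≤ c) {a : EReal} (ha : 0 ≤ a) : 0 ≤ smulE c a := by
  unfold smulE
  split_ifs
  · exact le_top
  · exact mul_nonneg (by exact_mod_cast hc) ha

theorem smulE_le_coe_iff {c : ℝ} (hc : 0 ≤ c) {a : EReal} (ha : a ≠ ⊥) {r : ℝ} :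
    smulE c a ≤ r ↔ ∃ s : ℝ, a ≤ s ∧ c * s ≤ r := by
  induction a with
  | bot => exact absurd rfl ha
  | coe t =>
    simp only [smulE_coe, EReal.coe_le_coe_iff]
    exact ⟨fun h => ⟨t, le_rfl, h⟩, fun ⟨s, hs, h⟩ => (mul_le_mul_of_nonneg_left hs hc).trans h⟩
  | top => simp [smulE_top]

theorem ConvexE.smulE {X : Type*} [AddCommGroup X] [Module ℝ X] {g : X → EReal} (hg : ConvexE g)
    (hne : ∀ x, g x ≠ ⊥) {c : ℝ} (hc : 0 ≤ c) : ConvexE fun x => smulE c (g x) := by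
  rintro ⟨x, r⟩ hx ⟨y, s⟩ hy a b ha hb hab
  simp only [Set.mem_ofPred_eq, smulE_le_coe_iff hc (hne _)] at hx hy ⊢
  obtain ⟨r', hr', hr⟩ := hx
  obtain ⟨s', hs', hs⟩ := hy
  refine ⟨a * r' + b * s', hg.le hr' hs' ha hb hab, ?_⟩
  simp only [Prod.snd_add, Prod.smul_snd, smul_eq_mul]
  nlinarith [mul_le_mul_of_nonneg_left hr ha, mul_le_mul_of_nonneg_left hs hb]

theorem ConvexE.max_zero {X : Type*} [AddCommGroup X] [Module ℝ X] {g : X → EReal}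
    (hg : ConvexE g) : ConvexE fun x => max (g x) 0 := by
  rintro ⟨x, r⟩ hx ⟨y, s⟩ hy a b ha hb hab
  simp only [Set.mem_ofPred_eq, max_le_iff, EReal.coe_nonneg] at hx hy ⊢
  exact ⟨hg.le hx.1 hy.1 ha hb hab, add_nonneg (mul_nonneg ha hx.2) (mul_nonneg hb hy.2)⟩

theorem exists_multiplier_of_slater {E : Type*} [AddCommGroup E] [Module ℝ E] {K : Set E}
    (hK : Convex ℝ K) {φ g : E →ₗ[ℝ] ℝ} {v : ℝ} {x₀ : E} (hx₀ : x₀ ∈ K) (hg₀ : g x₀ < 0)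
    (h : ∀ x ∈ K, g x ≤ 0 → v ≤ φ x) : ∃ l : ℝ, 0 ≤ l ∧ ∀ x ∈ K, v ≤ φ x + l * g x := by
  let A : Set ℝ := insert 0 ((fun x => (v - φ x) / g x) '' {x | x ∈ K ∧ 0 < g x})
  have hA : ∀ y ∈ K, g y < 0 → ∀ a ∈ A, a ≤ (φ y - v) / (-g y) := by
    rintro y hy hgy a (rfl | ⟨x, ⟨hx, hgx⟩, rfl⟩)
    · exact div_nonneg (sub_nonneg.2 (h y hy hgy.le)) (by linarith)
    · have hpos : 0 < g x - g y := by linarith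
      have hz := hK hy hx (a := g x / (g x - g y)) (b := -g y / (g x - g y))
        (by positivity) (div_nonneg (by linarith) hpos.le) (by field_simp; ring)
      have hv := h _ hz (by
        simp only [map_add, map_smul, smul_eq_mul]
        apply le_of_eq
        field_simp
        ring)
      simp only [map_add, map_smul, smul_eq_mul] at hv
      rw [div_mul_eq_mul_div, div_mul_eq_mul_div, ← add_div, le_div_iff₀ hpos] at hv
      simp only
      rw [div_le_div_iff₀ hgx (by linarith)]
      linarith
  have hbdd : BddAbove A := ⟨_, hA x₀ hx₀ hg₀⟩
  have hne : A.Nonempty := ⟨0, Set.mem_insert _ _⟩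
  refine ⟨sSup A, le_csSup hbdd (Set.mem_insert _ _), fun x hx => ?_⟩
  rcases lt_trichotomy (g x) 0 with hgx | hgx | hgx
  · have := csSup_le hne (hA x hx hgx)
    rw [le_div_iff₀ (by linarith)] at this
    linarith
  · rw [hgx, mul_zero, add_zero]
    exact h x hx hgx.le
  · have := le_csSup hbdd (Set.mem_insert_of_mem _ ⟨x, ⟨hx, hgx⟩, rfl⟩)
    rw [div_le_iff₀ hgx] at this
    linarith

theorem exists_multipliers_of_slater {E ι : Type*} [AddCommGroup E] [Module ℝ E]
    (s : Finset ι) {K : Set E} (hK : Convex ℝ K) {φ : E →ₗ[ℝ] ℝ} {g : ι → E →ₗ[ℝ] ℝ} {v : ℝ}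
    {x₀ : E} (hx₀ : x₀ ∈ K) (hg₀ : ∀ i ∈ s, g i x₀ < 0)
    (h : ∀ x ∈ K, (∀ i ∈ s, g i x ≤ 0) → v ≤ φ x) :
    ∃ l : ι → ℝ, (∀ i, 0 ≤ l i) ∧ ∀ x ∈ K, v ≤ φ x + ∑ i ∈ s, l i * g i x := by
  classical
  induction s using Finset.induction_on generalizing φ with
  | empty => exact ⟨0, fun _ => le_rfl, fun x hx => by simpa using h x hx (by simp)⟩
  | insert a s ha ih =>
    have hK' : Convex ℝ (K ∩ {x | ∀ i ∈ s, g i x ≤ 0}) := by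
      refine hK.inter ?_
      intro x hx y hy b c hb hc hbc i hi
      rw [map_add, map_smul, map_smul]
      exact add_nonpos (mul_nonpos_of_nonneg_of_nonpos hb (hx i hi))
        (mul_nonpos_of_nonneg_of_nonpos hc (hy i hi))
    obtain ⟨t, ht, htv⟩ := exists_multiplier_of_slater hK' (φ := φ) (g := g a) (v := v)
      ⟨hx₀, fun i hi => (hg₀ i (by simp [hi])).le⟩ (hg₀ a (by simp))
      (fun x hx hgx => h x hx.1 fun i hi => by
        rcases Finset.mem_insert.1 hi with rfl | hi
        · exact hgx
        · exact hx.2 i hi)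
    obtain ⟨l, hl, hlv⟩ := ih (φ := φ + t • g a) (fun i hi => hg₀ i (by simp [hi]))
      fun x hx hxs => by simpa using htv x ⟨hx, hxs⟩
    refine ⟨Function.update l a t, fun i => ?_, fun x hx => ?_⟩
    · rcases eq_or_ne i a with rfl | hi
      · simpa using ht
      · simpa [hi] using hl i
    · have h1 := hlv x hx
      have h2 : ∑ i ∈ s, Function.update l a t i * g i x = ∑ i ∈ s, l i * g i x :=
        Finset.sum_congr rfl fun i hi => by
          rw [Function.update_of_ne (ne_of_mem_of_not_mem hi ha)]
      rw [Finset.sum_insert ha, h2, Function.update_self]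
      simp only [LinearMap.add_apply, LinearMap.smul_apply, smul_eq_mul] at h1
      linarith

theorem sum_Icc_le_limsup {a : ℕ → EReal} (ha : ∀ k, 0 ≤ a k) (m n : ℕ) :
    ∑ k ∈ Finset.Icc (m + 1) n, a k ≤
      Filter.limsup (fun n => ∑ k ∈ Finset.Icc (m + 1) n, a k) Filter.atTop := by
  refine Filter.le_limsup_of_frequently_le (Filter.Eventually.frequently ?_)
  filter_upwards [Filter.eventually_ge_atTop n] with j hj
  exact Finset.sum_le_sum_of_subset_of_nonneg (Finset.Icc_subset_Icc le_rfl hj) fun i _ _ => ha i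

/-- Strong duality with attainment for the dual problem with mixed multipliers. -/
theorem exists_le_lagDm {X : Type*} [AddCommGroup X] [Module ℝ X] {f : ℕ → X → EReal}
    (hne : ∀ k x, f k x ≠ ⊥) (hconv : ∀ k, ConvexE (f k)) (hslater : SlaterE f) {v : ℝ}
    (hv : ∀ x, feasE f x → (v : EReal) ≤ f 0 x) (m : ℕ) :
    ∃ μ : ℕ → ℝ, memLinfty μ ∧ ∀ x, (v : EReal) ≤ lagDm f m μ x := by
  obtain ⟨x₀, hx₀, hsup⟩ := hslater
  obtain ⟨q, hq, hq0⟩ := EReal.lt_iff_exists_real_btwn.1 hsup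
  have hq0 : q < 0 := by exact_mod_cast hq0
  set η : ℝ := -q
  have hη : 0 < η := by simp only [η]; linarith
  have hfη : ∀ k, 1 ≤ k → f k x₀ ≤ ((-η : ℝ) : EReal) := fun k hk => by
    simp only [η, neg_neg]
    exact (le_iSup₂ (f := fun k (_ : 1 ≤ k) => f k x₀) k hk).trans hq.le
  obtain ⟨a₀, ha₀⟩ : ∃ r : ℝ, f 0 x₀ = r := ⟨_, (EReal.coe_toReal hx₀ (hne 0 x₀)).symm⟩
  have hva : v ≤ a₀ := by
    have := hv x₀ fun k hk => (hfη k hk).trans (by exact_mod_cast (neg_neg_of_pos hη).le)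
    rw [ha₀] at this
    exact_mod_cast this
  set ρ : ℝ := (a₀ - v) / η + 1
  have hρ : 0 < ρ := add_pos_of_nonneg_of_pos (div_nonneg (by linarith) hη.le) one_pos
  let K : Set (X × (ℕ → ℝ) × ℝ) := {z | f 0 z.1 ≤ z.2.1 0 ∧
    (∀ k ∈ Finset.Icc 1 m, f k z.1 ≤ z.2.1 k) ∧ (∀ k, m < k → f k z.1 ≤ z.2.2) ∧ 0 ≤ z.2.2}
  have hK : Convex ℝ K := by
    rintro x ⟨h1, h2, h3, h4⟩ y ⟨h1', h2', h3', h4'⟩ a b ha hb hab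
    exact ⟨(hconv 0).le h1 h1' ha hb hab,
      fun k hk => (hconv k).le (h2 k hk) (h2' k hk) ha hb hab,
      fun k hk => (hconv k).le (h3 k hk) (h3' k hk) ha hb hab,
      add_nonneg (mul_nonneg ha h4) (mul_nonneg hb h4')⟩
  let coord : ℕ → (X × (ℕ → ℝ) × ℝ) →ₗ[ℝ] ℝ := fun k =>
    LinearMap.proj k ∘ₗ LinearMap.fst ℝ (ℕ → ℝ) ℝ ∘ₗ LinearMap.snd ℝ X ((ℕ → ℝ) × ℝ)
  let φ : (X × (ℕ → ℝ) × ℝ) →ₗ[ℝ] ℝ :=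
    coord 0 + ρ • (LinearMap.snd ℝ (ℕ → ℝ) ℝ ∘ₗ LinearMap.snd ℝ X ((ℕ → ℝ) × ℝ))
  have hcoord : ∀ k z, coord k z = z.2.1 k := fun k z => rfl
  have hφ : ∀ z, φ z = z.2.1 0 + ρ * z.2.2 := fun z => rfl
  obtain ⟨l, hl, hlv⟩ := exists_multipliers_of_slater (Finset.Icc 1 m) hK (φ := φ) (g := coord)
    (v := v) (x₀ := (x₀, fun k => if k = 0 then a₀ else -η, 0))
    ⟨by simp [ha₀], fun k hk => by
        have hk1 := (Finset.mem_Icc.1 hk).1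
        simpa [show k ≠ 0 by omega] using hfη k hk1,
      fun k hk => (hfη k (by omega)).trans (by exact_mod_cast (neg_neg_of_pos hη).le), le_rfl⟩
    (fun k hk => by
      have hk1 := (Finset.mem_Icc.1 hk).1
      simp only [hcoord, show k ≠ 0 by omega, if_false]
      linarith)
    (by
      rintro ⟨x, r, s⟩ ⟨h1, h2, h3, h4⟩ hr
      simp only [hcoord] at hr
      simp only at h1 h2 h3 h4
      rw [hφ]
      simp only
      have hpos : 0 < s + η := by linarith
      have hab : s / (s + η) + η / (s + η) = 1 := by field_simp
      have hs0 : 0 ≤ s / (s + η) := by positivity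
      have hη0 : 0 ≤ η / (s + η) := by positivity
      have hfeas : feasE f ((s / (s + η)) • x₀ + (η / (s + η)) • x) := by
        intro k hk
        by_cases hkm : k ≤ m
        · have hk' := Finset.mem_Icc.2 ⟨hk, hkm⟩
          refine ((hconv k).le (hfη k hk) (h2 k hk') hs0 hη0 hab).trans ?_
          have := hr k hk'
          norm_cast
          nlinarith [mul_nonneg hs0 hη.le, mul_nonneg hη0 (neg_nonneg.2 this)]
        · refine ((hconv k).le (hfη k hk) (h3 k (by omega)) hs0 hη0 hab).trans ?_
          norm_cast
          apply le_of_eq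
          field_simp
          ring
      have hv1 : v ≤ s / (s + η) * a₀ + η / (s + η) * r 0 := by
        exact_mod_cast (hv _ hfeas).trans ((hconv 0).le ha₀.le h1 hs0 hη0 hab)
      rw [div_mul_eq_mul_div, div_mul_eq_mul_div, ← add_div, le_div_iff₀ hpos] at hv1
      have hρη : ρ * η = a₀ - v + η := by simp only [ρ]; field_simp
      have : 0 ≤ η * (r 0 + ρ * s - v) := by nlinarith
      linarith [nonneg_of_mul_nonneg_right this hη])
  refine ⟨fun k => if k ≤ m then l k else ρ, ⟨⟨∑ k ∈ Finset.range (m + 1), l k + ρ, fun k => ?_⟩,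
    fun k => ?_⟩, fun x => ?_⟩
  · simp only
    have hnn : 0 ≤ ∑ k ∈ Finset.range (m + 1), l k := Finset.sum_nonneg fun i _ => hl i
    split_ifs with hk
    · rw [abs_of_nonneg (hl k)]
      have := Finset.single_le_sum (f := l) (fun i _ => hl i)
        (Finset.mem_range.2 (Nat.lt_succ_of_le hk))
      linarith
    · rw [abs_of_pos hρ]
      linarith
  · simp only
    split_ifs
    · exact hl k
    · exact hρ.le
  · set μ : ℕ → ℝ := fun k => if k ≤ m then l k else ρ
    have hμ : ∀ k, 0 ≤ μ k := fun k => by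
      simp only [μ]
      split_ifs
      · exact hl k
      · exact hρ.le
    set L := Filter.limsup (fun n => ∑ k ∈ Finset.Icc (m + 1) n, smulE (μ k) (max (f k x) 0))
      Filter.atTop with hL
    have hterm : ∀ k, 0 ≤ smulE (μ k) (max (f k x) 0) := fun k =>
      smulE_nonneg (hμ k) (le_max_right _ _)
    have hLle := sum_Icc_le_limsup hterm m
    rw [← hL] at hLle
    have hL0 : 0 ≤ L := (Finset.sum_nonneg fun k _ => hterm k).trans (hLle 0)
    have hLb : L ≠ ⊥ := ne_bot_of_le_ne_bot (by simp) hL0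
    have hsb : ∑ k ∈ Finset.Icc 1 m, smulE (μ k) (f k x) ≠ ⊥ :=
      EReal.sum_ne_bot fun k _ => smulE_ne_bot (hne k x)
    unfold lagDm
    rw [← hL]
    by_cases htop : f 0 x + ∑ k ∈ Finset.Icc 1 m, smulE (μ k) (f k x) + L = ⊤
    · rw [htop]; exact le_top
    obtain ⟨h01, hLt⟩ := (EReal.add_ne_top_iff_ne_top₂
      (EReal.add_ne_bot_iff.2 ⟨hne 0 x, hsb⟩) hLb).1 htop
    obtain ⟨h0t, hst⟩ := (EReal.add_ne_top_iff_ne_top₂ (hne 0 x) hsb).1 h01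
    obtain ⟨w, hw⟩ := EReal.exists_coe_of_sum_ne_top (fun k _ => smulE_ne_bot (hne k x)) hst
    have hfr : ∀ k, f k x ≠ ⊤ → f k x = ((f k x).toReal : EReal) := fun k hk =>
      (EReal.coe_toReal hk (hne k x)).symm
    have hfk : ∀ k ∈ Finset.Icc 1 m, f k x ≠ ⊤ := fun k hk ht => by
      have := hw k hk
      rw [ht, smulE_top] at this
      exact EReal.coe_ne_top _ this.symm
    obtain ⟨L', hL'⟩ : ∃ L' : ℝ, L = L' := ⟨_, (EReal.coe_toReal hLt hLb).symm⟩
    have hL'0 : 0 ≤ L' := by rw [hL'] at hL0; exact_mod_cast hL0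
    have hmem : (x, (fun k => (f k x).toReal), L' / ρ) ∈ K := by
      refine ⟨(hfr 0 h0t).le, fun k hk => (hfr k (hfk k hk)).le, fun k hk => ?_, by positivity⟩
      have h1 : smulE (μ k) (max (f k x) 0) ≤ L' := by
        rw [← hL']
        exact (Finset.single_le_sum (f := fun k => smulE (μ k) (max (f k x) 0))
          (fun i _ => hterm i) (Finset.mem_Icc.2 ⟨hk, le_rfl⟩)).trans (hLle k)
      obtain ⟨s, hs, hsL⟩ := (smulE_le_coe_iff (hμ k)
        (ne_bot_of_le_ne_bot (hne k x) (le_max_left _ _))).1 h1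
      simp only [μ, show ¬ k ≤ m by omega, if_false] at hsL
      refine ((le_max_left _ _).trans hs).trans ?_
      norm_cast
      rwa [le_div_iff₀ hρ, mul_comm]
    have h2 := hlv _ hmem
    simp only [hφ, hcoord, mul_div_cancel₀ _ hρ.ne'] at h2
    have h3 : ∑ k ∈ Finset.Icc 1 m, smulE (μ k) (f k x) =
        ((∑ k ∈ Finset.Icc 1 m, l k * (f k x).toReal : ℝ) : EReal) := by
      rw [EReal.coe_finsetSum]
      refine Finset.sum_congr rfl fun k hk => ?_
      conv_lhs => rw [hfr k (hfk k hk), smulE_coe]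
      simp only [μ, (Finset.mem_Icc.1 hk).2, if_true]
    rw [h3, hfr 0 h0t, hL']
    norm_cast
    have h4 : ρ * (L' / ρ) = L' := by field_simp
    linarith

theorem mem_normalConeE_or_smul_subdiffE {X : Type*} [NormedAddCommGroup X] [NormedSpace ℝ X]
    {g : X → EReal} (hne : ∀ x, g x ≠ ⊥) {c : ℝ} (hc : 0 ≤ c) {x₀ : X} (hx₀ : g x₀ ≠ ⊤)
    {p : X →L[ℝ] ℝ} (hp : p ∈ subdiffE (fun x => smulE c (g x)) x₀) :
    p ∈ if c = 0 then normalConeE g x₀ else c • subdiffE g x₀ := by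
  obtain ⟨a, ha⟩ : ∃ a : ℝ, g x₀ = a := ⟨_, (EReal.coe_toReal hx₀ (hne x₀)).symm⟩
  have key : ∀ x (s : ℝ), g x = s → c * a + p (x - x₀) ≤ c * s := fun x s hs => by
    have h := hp x
    simp only [ha, hs, smulE_coe] at h
    exact_mod_cast h
  split_ifs with h0
  · intro x hx
    have := key x _ (EReal.coe_toReal hx (hne x)).symm
    simpa [h0] using this
  · have hc' : 0 < c := lt_of_le_of_ne hc (Ne.symm h0)
    refine ⟨c⁻¹ • p, fun x => ?_, smul_inv_smul₀ h0 p⟩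
    rcases eq_or_ne (g x) ⊤ with htop | htop
    · rw [htop]; exact le_top
    obtain ⟨s, hs⟩ : ∃ s : ℝ, g x = s := ⟨_, (EReal.coe_toReal htop (hne x)).symm⟩
    rw [ha, hs]
    norm_cast
    have h1 := key x s hs
    have h2 : p (x - x₀) ≤ c * (s - a) := by linarith
    rw [← inv_mul_le_iff₀ hc'] at h2
    simp only [smul_apply, smul_eq_mul]
    linarith

theorem normalConeE_max_zero {X : Type*} [NormedAddCommGroup X] [NormedSpace ℝ X]
    (g : X → EReal) (x₀ : X) : normalConeE (fun x => max (g x) 0) x₀ = normalConeE g x₀ := by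
  have h : ∀ x, max (g x) 0 ≠ ⊤ ↔ g x ≠ ⊤ := fun x => by simp [max_eq_top]
  simp only [normalConeE, h]

theorem sum_range_succ_eq_add_sum_Icc {A : Type*} [AddCommMonoid A] (a : ℕ → A) {m n : ℕ}
    (hmn : m ≤ n) : ∑ k ∈ Finset.range (n + 1), a k =
      a 0 + ∑ k ∈ Finset.Icc 1 m, a k + ∑ k ∈ Finset.Icc (m + 1) n, a k := by
  have h₁ : Finset.Icc 1 m = Finset.Ico 1 (m + 1) := by ext; simp
  have h₂ : Finset.Icc (m + 1) n = Finset.Ico (m + 1) (n + 1) := by ext; simp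
  rw [h₁, h₂, add_assoc, Finset.sum_Ico_consecutive _ (by omega) (by omega), Finset.range_eq_Ico,
    Finset.sum_eq_sum_Ico_succ_bot (by omega)]

section collDm

variable {X : Type*} {f : ℕ → X → EReal} {m : ℕ} {lam : ℕ → ℝ}

theorem collDm_zero : collDm f m lam 0 = f 0 := by
  ext x; simp [collDm]

theorem collDm_of_le {k : ℕ} (h1 : 1 ≤ k) (hk : k ≤ m) :
    collDm f m lam k = fun x => smulE (lam k) (f k x) := by
  ext x; simp [collDm, hk, show k ≠ 0 by omega]

theorem collDm_of_lt {k : ℕ} (hk : m < k) :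
    collDm f m lam k = fun x => smulE (lam k) (max (f k x) 0) := by
  ext x; simp [collDm, show ¬ k ≤ m by omega, show k ≠ 0 by omega]

theorem collDm_induction {P : (X → EReal) → Prop} (k : ℕ) (h0 : P (f 0))
    (hle : P fun x => smulE (lam k) (f k x)) (hlt : P fun x => smulE (lam k) (max (f k x) 0)) :
    P (collDm f m lam k) := by
  rcases Nat.eq_zero_or_pos k with rfl | h
  · rwa [collDm_zero]
  rcases le_or_gt k m with hk | hk
  · rwa [collDm_of_le h hk]
  · rwa [collDm_of_lt hk]

theorem collDm_ne_bot (hne : ∀ k x, f k x ≠ ⊥) (k : ℕ) (x : X) : collDm f m lam k x ≠ ⊥ := by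
  refine collDm_induction (P := fun g => g x ≠ ⊥) k (hne 0 x) (smulE_ne_bot (hne k x))
    (smulE_ne_bot (ne_bot_of_le_ne_bot (hne k x) (le_max_left _ _)))

theorem sum_collDm (x : ℕ → X) {n : ℕ} (hmn : m ≤ n) :
    ∑ k ∈ Finset.range (n + 1), collDm f m lam k (x k) =
      f 0 (x 0) + ∑ k ∈ Finset.Icc 1 m, smulE (lam k) (f k (x k)) +
        ∑ k ∈ Finset.Icc (m + 1) n, smulE (lam k) (max (f k (x k)) 0) := by
  rw [sum_range_succ_eq_add_sum_Icc _ hmn, collDm_zero]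
  congr 1
  · congr 1
    refine Finset.sum_congr rfl fun k hk => ?_
    rw [collDm_of_le (Finset.mem_Icc.1 hk).1 (Finset.mem_Icc.1 hk).2]
  · refine Finset.sum_congr rfl fun k hk => ?_
    rw [collDm_of_lt (Finset.mem_Icc.1 hk).1]

theorem lagDm_le_upperSum (hne : ∀ k x, f k x ≠ ⊥) (hlam : ∀ k, 0 ≤ lam k) (x : X) :
    lagDm f m lam x ≤ upperSum (collDm f m lam) x := by
  refine le_iInf fun S₀ => ?_
  set W := ⨆ S : Finset ℕ, ⨆ _ : S₀ ⊆ S, ∑ t ∈ S, collDm f m lam t x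
  have hterm : ∀ k, 0 ≤ smulE (lam k) (max (f k x) 0) := fun k =>
    smulE_nonneg (hlam k) (le_max_right _ _)
  set A := f 0 x + ∑ k ∈ Finset.Icc 1 m, smulE (lam k) (f k x)
  have hA : A ≠ ⊥ := EReal.add_ne_bot_iff.2
    ⟨hne 0 x, EReal.sum_ne_bot fun k _ => smulE_ne_bot (hne k x)⟩
  have hW : ∀ n, m ≤ n → A + ∑ k ∈ Finset.Icc (m + 1) n, smulE (lam k) (max (f k x) 0) ≤ W := by
    intro n hn
    rw [← sum_collDm (fun _ => x) hn]
    refine le_trans ?_ (le_iSup₂ (f := fun (S : Finset ℕ) (_ : S₀ ⊆ S) =>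
      ∑ t ∈ S, collDm f m lam t x) (S₀ ∪ Finset.range (n + 1)) Finset.subset_union_left)
    refine Finset.sum_le_sum_of_subset_of_nonneg Finset.subset_union_right fun k _ hk => ?_
    rw [collDm_of_lt (by simp at hk; omega)]
    exact hterm k
  change A + _ ≤ W
  induction hAe : A with
  | bot => exact absurd hAe hA
  | top =>
    have h := hW m le_rfl
    rw [hAe, EReal.top_add_of_ne_bot (EReal.sum_ne_bot fun k _ =>
      ne_bot_of_le_ne_bot (by simp) (hterm k))] at h
    exact le_top.trans h
  | coe r =>
    rw [add_comm, ← EReal.le_sub_iff_add_le (Or.inl (EReal.coe_ne_bot r))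
      (Or.inl (EReal.coe_ne_top r))]
    refine Filter.limsup_le_of_le (by isBoundedDefault) ?_
    filter_upwards [Filter.eventually_ge_atTop m] with n hn
    rw [EReal.le_sub_iff_add_le (Or.inl (EReal.coe_ne_bot r))
      (Or.inl (EReal.coe_ne_top r)), add_comm, ← hAe]
    exact hW n hn

end collDm

theorem smulE_eq_zero_of_le_lagDm {X : Type*} {f : ℕ → X → EReal} (hne : ∀ k x, f k x ≠ ⊥)
    {m : ℕ} {lam : ℕ → ℝ} (hlam : ∀ k, 0 ≤ lam k) {x : X} (hx : feasE f x) (h0 : f 0 x ≠ ⊤)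
    (hle : f 0 x ≤ lagDm f m lam x) {k : ℕ} (h1 : 1 ≤ k) (hk : k ≤ m) :
    smulE (lam k) (f k x) = 0 := by
  have hr : ∀ k, 1 ≤ k → f k x = ((f k x).toReal : EReal) := fun k hk =>
    (EReal.coe_toReal (ne_top_of_le_ne_top (by simp) (hx k hk)) (hne k x)).symm
  have hterm : ∀ k, 1 ≤ k → smulE (lam k) (f k x) = ((lam k * (f k x).toReal : ℝ) : EReal) :=
    fun k hk => by conv_lhs => rw [hr k hk, smulE_coe]
  have hnonpos : ∀ k, 1 ≤ k → lam k * (f k x).toReal ≤ 0 := fun k hk => by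
    refine mul_nonpos_of_nonneg_of_nonpos (hlam k) ?_
    have := hx k hk
    rw [hr k hk] at this
    exact_mod_cast this
  have htail : ∀ n, ∑ k ∈ Finset.Icc (m + 1) n, smulE (lam k) (max (f k x) 0) = 0 := fun n =>
    Finset.sum_eq_zero fun k hk => by
      rw [max_eq_right (hx k (by have := (Finset.mem_Icc.1 hk).1; omega)), ← EReal.coe_zero,
        smulE_coe, mul_zero]
  have hsum : ∑ k ∈ Finset.Icc 1 m, smulE (lam k) (f k x) =
      ((∑ k ∈ Finset.Icc 1 m, lam k * (f k x).toReal : ℝ) : EReal) := by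
    rw [EReal.coe_finsetSum]
    exact Finset.sum_congr rfl fun k hk => hterm k (Finset.mem_Icc.1 hk).1
  simp only [lagDm, htail, Filter.limsup_const, add_zero, hsum] at hle
  rw [← EReal.coe_toReal h0 (hne 0 x)] at hle
  have h2 : 0 ≤ ∑ k ∈ Finset.Icc 1 m, lam k * (f k x).toReal := by
    have : (f 0 x).toReal ≤ (f 0 x).toReal + ∑ k ∈ Finset.Icc 1 m, lam k * (f k x).toReal := by
      exact_mod_cast hle
    linarith
  have h3 := (Finset.sum_eq_zero_iff_of_nonpos fun k hk =>
    hnonpos k (Finset.mem_Icc.1 hk).1).1 (le_antisymm (Finset.sum_nonpos fun k hk =>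
      hnonpos k (Finset.mem_Icc.1 hk).1) h2) k (Finset.mem_Icc.2 ⟨h1, hk⟩)
  rw [hterm k h1, h3, EReal.coe_zero]

/-- Optimality conditions (multiplier rule) for problem (P) via a solution of the
dual problem (D_m), under lower semicontinuity and uniform lower semicontinuity
assumptions on a neighbourhood of the solution x̄. -/
theorem optimality_conditions_via_Dm
    {X : Type*} [NormedAddCommGroup X] [NormedSpace ℝ X] [CompleteSpace X]
    (f : ℕ → X → EReal)
    (hproper : ∀ k, ProperE (f k)) (hconv : ∀ k, ConvexE (f k))
    (hC : ∃ x : X, f 0 x ≠ ⊤ ∧ feasE f x)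
    (xb : X) (hfeas : feasE f xb) (hmin : ∀ x : X, feasE f x → f 0 xb ≤ f 0 x)
    (hslater : SlaterE f)
    (m : ℕ) (lam : ℕ → ℝ) (hlam : memLinfty lam)
    (hsol : (⨅ x : X, lagDm f m lam x) = vDm f m)
    (hi : ∃ δ : ℝ, 0 < δ ∧ ∀ k : ℕ,
        LowerSemicontinuousOn (collDm f m lam k) (Metric.ball xb δ))
    (hii : ∃ δ : ℝ, 0 < δ ∧
        (⨅ x ∈ Metric.ball xb δ, upperSum (collDm f m lam) x) ≤
          unifInf (collDm f m lam) (Metric.ball xb δ)) :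
    (∀ k, 1 ≤ k → k ≤ m → smulE (lam k) (f k xb) = 0) ∧
    ∀ ε : ℝ, 0 < ε → ∀ M : ℕ, m < M → ∃ n : ℕ, M < n ∧
      ∃ x : ℕ → X,
        (∀ k ≤ n, x k ∈ Metric.ball xb ε) ∧
        f 0 (x 0) + (∑ k ∈ Finset.Icc 1 m, smulE (lam k) (f k (x k))) +
            (∑ k ∈ Finset.Icc (m + 1) n, smulE (lam k) (max (f k (x k)) 0)) ≤ f 0 xb ∧
        (0 : X →L[ℝ] ℝ) ∈ subdiffE (f 0) (x 0) +
          (∑ k ∈ Finset.Icc 1 m,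
            (if lam k = 0 then normalConeE (f k) (x k) else lam k • subdiffE (f k) (x k))) +
          (∑ k ∈ Finset.Icc (m + 1) n,
            (if lam k = 0 then normalConeE (f k) (x k)
              else lam k • subdiffE (fun y => max (f k y) 0) (x k))) +
          Metric.ball (0 : X →L[ℝ] ℝ) ε := by
  have hne : ∀ k x, f k x ≠ ⊥ := fun k => (hproper k).1
  have h0 : f 0 xb ≠ ⊤ := by
    obtain ⟨x, hx, hxf⟩ := hC
    exact ne_top_of_le_ne_top hx (hmin x hxf)
  obtain ⟨v, hv⟩ : ∃ v : ℝ, f 0 xb = v := ⟨_, (EReal.coe_toReal h0 (hne 0 xb)).symm⟩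
  have hlag : ∀ x, (v : EReal) ≤ lagDm f m lam x := by
    obtain ⟨μ, hμ, hμv⟩ := exists_le_lagDm hne hconv hslater (hv ▸ hmin) m
    have h1 : (v : EReal) ≤ vDm f m := (le_iInf hμv).trans
      (le_iSup₂ (f := fun (μ : ℕ → ℝ) (_ : memLinfty μ) => ⨅ x : X, lagDm f m μ x) μ hμ)
    rw [← hsol] at h1
    exact fun x => h1.trans (iInf_le _ x)
  have hcs : ∀ k, 1 ≤ k → k ≤ m → smulE (lam k) (f k xb) = 0 := fun k h1 hk =>
    smulE_eq_zero_of_le_lagDm hne hlam.2 hfeas h0 (hv ▸ hlag xb) h1 hk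
  refine ⟨hcs, fun ε hε M hM => ?_⟩
  obtain ⟨δ₁, hδ₁, hlsc⟩ := hi
  obtain ⟨δ₂, hδ₂, hunif⟩ := hii
  set R : ℝ := min ε (min δ₁ δ₂)
  have hR : 0 < R := by positivity
  have hRε : Metric.ball xb R ⊆ Metric.ball xb ε := Metric.ball_subset_ball (min_le_left _ _)
  have hR₁ : Metric.ball xb R ⊆ Metric.ball xb δ₁ :=
    Metric.ball_subset_ball ((min_le_right _ _).trans (min_le_left _ _))
  have hR₂ : Metric.ball xb R ⊆ Metric.ball xb δ₂ :=
    Metric.ball_subset_ball ((min_le_right _ _).trans (min_le_right _ _))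
  set e : ℝ := ε * R / 8
  have he : 0 < e := by positivity
  have hve : ((v - e : ℝ) : EReal) < unifInf (collDm f m lam) (Metric.ball xb δ₂) := by
    have h1 : ((v - e : ℝ) : EReal) < v := by exact_mod_cast sub_lt_self v he
    refine (h1.trans_le (le_iInf₂ fun x _ => ?_)).trans_le hunif
    exact (hlag x).trans (lagDm_le_upperSum hne hlam.2 x)
  obtain ⟨S₀, hS₀⟩ := lt_iSup_iff.1 hve
  set n : ℕ := max (M + 1) (S₀.sup id)
  have hMn : M < n := lt_of_lt_of_le (Nat.lt_succ_self M) (le_max_left _ _)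
  have hmn : m ≤ n := (hM.trans hMn).le
  have hS₀n : S₀ ⊆ Finset.range (n + 1) := fun k hk => Finset.mem_range.2
    (Nat.lt_succ_of_le ((Finset.le_sup (f := id) hk).trans (le_max_right _ _)))
  have h2 := hS₀.trans_le (iInf₂_le (Finset.range (n + 1)) hS₀n)
  obtain ⟨δ, h3⟩ := lt_iSup_iff.1 h2
  obtain ⟨hδ0, hδ⟩ := lt_iSup_iff.1 h3
  let extend : (Fin (n + 1) → X) → ℕ → X := fun y k => if h : k < n + 1 then y ⟨k, h⟩ else xb
  have hext : ∀ y (i : Fin (n + 1)), extend y i = y i := fun y i => dif_pos i.isLt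
  have hsum : ∀ y : Fin (n + 1) → X, ∑ i : Fin (n + 1), collDm f m lam i (y i) =
      ∑ k ∈ Finset.range (n + 1), collDm f m lam k (extend y k) := fun y => by
    rw [Finset.sum_range]
    exact Finset.sum_congr rfl fun i _ => by rw [hext]
  have hvb : ∑ i : Fin (n + 1), collDm f m lam i xb = v := by
    rw [← Finset.sum_range fun k => collDm f m lam k xb, sum_collDm (fun _ => xb) hmn, hv,
      Finset.sum_eq_zero fun k hk => hcs k (Finset.mem_Icc.1 hk).1 (Finset.mem_Icc.1 hk).2,
      Finset.sum_eq_zero fun k hk => ?_, add_zero, add_zero]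
    rw [max_eq_right (hfeas k (by have := (Finset.mem_Icc.1 hk).1; omega)), ← EReal.coe_zero,
      smulE_coe, mul_zero]
  obtain ⟨y, p, hy, hyv, hp, hpn⟩ := exists_subdiffE_norm_sum_le (0 : Fin (n + 1))
    (F := fun i => collDm f m lam i) (fun i => collDm_ne_bot hne i)
    (fun i => collDm_induction (P := ConvexE) i (hconv 0) ((hconv i).smulE (hne i) (hlam.2 i))
      ((hconv i).max_zero.smulE
        (fun x => ne_bot_of_le_ne_bot (hne i x) (le_max_left _ _)) (hlam.2 i)))
    hR (fun i => (hlsc i).mono hR₁) hvb he hδ0 fun z hz hzd => by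
      rw [hsum]
      refine (hδ.trans_le (iInf₂_le (extend z) ⟨fun k hk => ?_, fun k hk j hj => ?_⟩)).le
      · rw [hext z ⟨k, Finset.mem_range.1 hk⟩]
        exact hR₂ (hz _)
      · rw [hext z ⟨k, Finset.mem_range.1 hk⟩, hext z ⟨j, Finset.mem_range.1 hj⟩]
        exact hzd _ _
  let q : ℕ → X →L[ℝ] ℝ := fun k => if h : k < n + 1 then p ⟨k, h⟩ else 0
  have hqp : ∀ i : Fin (n + 1), q i = p i := fun i => dif_pos i.isLt
  have hq : ∀ k ≤ n, q k ∈ subdiffE (collDm f m lam k) (extend y k) := fun k hk => by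
    have hk' := Nat.lt_succ_of_le hk
    rw [hqp ⟨k, hk'⟩, hext y ⟨k, hk'⟩]
    exact hp ⟨k, hk'⟩
  have hqsum : ∑ i, p i = q 0 + ∑ k ∈ Finset.Icc 1 m, q k + ∑ k ∈ Finset.Icc (m + 1) n, q k := by
    rw [← sum_range_succ_eq_add_sum_Icc q hmn, Finset.sum_range]
    exact Finset.sum_congr rfl fun i _ => (hqp i).symm
  rw [hsum] at hyv
  have hfin : ∀ k ≤ n, collDm f m lam k (extend y k) ≠ ⊤ := fun k hk => by
    obtain ⟨r, hr⟩ := EReal.exists_coe_of_sum_ne_top (fun k _ => collDm_ne_bot hne k _)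
      (ne_top_of_le_ne_top (EReal.coe_ne_top v) hyv)
    rw [hr k (Finset.mem_range.2 (Nat.lt_succ_of_le hk))]
    exact EReal.coe_ne_top _
  refine ⟨n, hMn, extend y, fun k hk => ?_, ?_, ?_⟩
  · rw [hext y ⟨k, Nat.lt_succ_of_le hk⟩]
    exact hRε (hy _)
  · rwa [← sum_collDm (extend y) hmn, hv]
  · have hmem0 : q 0 ∈ subdiffE (f 0) (extend y 0) := by
      have := hq 0 (Nat.zero_le n)
      rwa [collDm_zero] at this
    have hmem1 : ∑ k ∈ Finset.Icc 1 m, q k ∈ ∑ k ∈ Finset.Icc 1 m,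
        (if lam k = 0 then normalConeE (f k) (extend y k)
          else lam k • subdiffE (f k) (extend y k)) := by
      refine Set.finsetSum_mem_finsetSum _ _ _ fun k hk => ?_
      obtain ⟨hk1, hkm⟩ := Finset.mem_Icc.1 hk
      have h1 := hq k (hkm.trans hmn)
      have h3 := hfin k (hkm.trans hmn)
      rw [collDm_of_le hk1 hkm] at h1 h3
      exact mem_normalConeE_or_smul_subdiffE (hne k) (hlam.2 k)
        (mt (smulE_eq_top_iff (hne k _)).2 h3) h1
    have hmem2 : ∑ k ∈ Finset.Icc (m + 1) n, q k ∈ ∑ k ∈ Finset.Icc (m + 1) n,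
        (if lam k = 0 then normalConeE (f k) (extend y k)
          else lam k • subdiffE (fun y => max (f k y) 0) (extend y k)) := by
      refine Set.finsetSum_mem_finsetSum _ _ _ fun k hk => ?_
      obtain ⟨hkm, hkn⟩ := Finset.mem_Icc.1 hk
      have h1 := hq k hkn
      have h3 := hfin k hkn
      have hne' : ∀ x, max (f k x) 0 ≠ ⊥ := fun x =>
        ne_bot_of_le_ne_bot (hne k x) (le_max_left _ _)
      rw [collDm_of_lt hkm] at h1 h3
      rw [← normalConeE_max_zero]
      exact mem_normalConeE_or_smul_subdiffE hne' (hlam.2 k)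
        (mt (smulE_eq_top_iff (hne' _)).2 h3) h1
    have hball : -∑ i, p i ∈ Metric.ball (0 : X →L[ℝ] ℝ) ε := by
      rw [mem_ball_zero_iff, norm_neg]
      refine hpn.trans_lt ?_
      have : 4 * e / R = ε / 2 := by simp only [e]; field_simp; norm_num
      linarith
    have := Set.add_mem_add (Set.add_mem_add (Set.add_mem_add hmem0 hmem1) hmem2) hball
    rwa [← hqsum, add_neg_cancel] at this

end
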